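/- Kleene's Theorem: a language l ⊆ A* over a finite alphabet A satisfies l = ⟦e⟧ for some regular expression e over A if and only if l = L(s) for some state s of a finite deterministic automaton (S, ⟨o_S, t_S⟩) over A. -/

import Mathlib

/-- Word derivative of a state: `dst t s w` is the state reached from `s` by reading `w`. -/
def dst {S A : Type*} (t : S → A → S) : S → List A → S
  | s, [] => s
  | s, a :: w => dst t (t s a) w

/-- The language recognized by a state `s` of the automaton `(S, ⟨o, t⟩)`. -/
def lang {S A : Type*} (o : S → Bool) (t : S → A → S) (s : S) : Language A :=
  {w : List A | o (dst t s w) = true}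

open scoped Computability

namespace Language

variable {A : Type*}

theorem mem_finset_sum {ι : Type*} (s : Finset ι) (f : ι → Language A) (w : List A) :
    w ∈ ∑ i ∈ s, f i ↔ ∃ i ∈ s, w ∈ f i := by
  classical
  induction s using Finset.induction_on with
  | empty => simp
  | insert i s hi ih => rw [Finset.sum_insert hi, mem_add, ih, Finset.exists_mem_insert]

theorem nil_mem_mul {l m : Language A} : [] ∈ l * m ↔ [] ∈ l ∧ [] ∈ m := by
  simp only [mem_mul, List.append_eq_nil_iff]
  exact ⟨fun ⟨_, hu, _, hv, h, h'⟩ ↦ ⟨h ▸ hu, h' ▸ hv⟩, fun ⟨hu, hv⟩ ↦ ⟨[], hu, [], hv, rfl, rfl⟩⟩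

theorem mem_sSup {T : Set (Language A)} {w : List A} : w ∈ sSup T ↔ ∃ l ∈ T, w ∈ l :=
  Set.mem_sUnion

/-! ### Letter derivatives -/

theorem leftQuotient_singleton_add (l m : Language A) (a : A) :
    (l + m).leftQuotient [a] = l.leftQuotient [a] + m.leftQuotient [a] :=
  rfl

theorem leftQuotient_singleton_sSup (T : Set (Language A)) (a : A) :
    (sSup T).leftQuotient [a] = sSup ((fun l ↦ l.leftQuotient [a]) '' T) := by
  ext w
  simp [mem_sSup]

theorem leftQuotient_singleton_mul_of_nil_mem {l : Language A} (hl : [] ∈ l) (m : Language A)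
    (a : A) :
    (l * m).leftQuotient [a] = l.leftQuotient [a] * m + m.leftQuotient [a] := by
  ext w
  simp only [mem_leftQuotient, mem_add, mem_mul, List.singleton_append]
  constructor
  · rintro ⟨_ | ⟨b, u⟩, hu, v, hv, h⟩
    · exact Or.inr (by simpa using h ▸ hv)
    · obtain ⟨rfl, rfl⟩ := List.cons_eq_cons.1 h
      exact Or.inl ⟨u, hu, v, hv, rfl⟩
  · rintro (⟨u, hu, v, hv, rfl⟩ | hw)
    · exact ⟨a :: u, hu, v, hv, rfl⟩
    · exact ⟨[], hl, a :: w, hw, rfl⟩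

theorem leftQuotient_singleton_mul_of_nil_notMem {l : Language A} (hl : [] ∉ l) (m : Language A)
    (a : A) :
    (l * m).leftQuotient [a] = l.leftQuotient [a] * m := by
  ext w
  simp only [mem_leftQuotient, mem_mul, List.singleton_append]
  constructor
  · rintro ⟨_ | ⟨b, u⟩, hu, v, hv, h⟩
    · exact absurd hu hl
    · obtain ⟨rfl, rfl⟩ := List.cons_eq_cons.1 h
      exact ⟨u, hu, v, hv, rfl⟩
  · rintro ⟨u, hu, v, hv, rfl⟩
    exact ⟨a :: u, hu, v, hv, rfl⟩

theorem leftQuotient_singleton_kstar (l : Language A) (a : A) :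
    (l∗).leftQuotient [a] = l.leftQuotient [a] * l∗ := by
  ext w
  simp only [mem_leftQuotient, mem_mul, List.singleton_append]
  constructor
  · intro h
    obtain ⟨_ | ⟨_ | ⟨b, u⟩, L⟩, h, hL⟩ := mem_kstar_iff_exists_nonempty.1 h
    · simp at h
    · exact absurd rfl (hL [] (by simp)).2
    · obtain ⟨rfl, rfl⟩ := List.cons_eq_cons.1 h
      exact ⟨u, (hL _ (by simp)).1, L.flatten,
        join_mem_kstar fun y hy ↦ (hL y (List.mem_cons_of_mem _ hy)).1, rfl⟩
  · rintro ⟨u, hu, v, hv, rfl⟩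
    rw [← one_add_self_mul_kstar_eq_kstar l]
    exact Or.inr ⟨a :: u, hu, v, hv, rfl⟩

/-! ### Closure properties of regular languages -/

theorem IsRegular.of_finite_closed {F : Set (Language A)} (hF : F.Finite)
    (hclosed : ∀ l ∈ F, ∀ a, l.leftQuotient [a] ∈ F) {l : Language A} (hl : l ∈ F) :
    l.IsRegular := by
  refine .of_finite_range_leftQuotient (hF.subset ?_)
  rintro _ ⟨w, rfl⟩
  induction w using List.reverseRecOn with
  | nil => exact hl
  | append_singleton w a ih =>
    rw [leftQuotient_append]
    exact hclosed _ ih a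

theorem leftQuotient_singleton_mem_range {l k : Language A} (hk : k ∈ Set.range l.leftQuotient)
    (a : A) : k.leftQuotient [a] ∈ Set.range l.leftQuotient := by
  obtain ⟨w, rfl⟩ := hk
  exact ⟨w ++ [a], leftQuotient_append _ _ _⟩

theorem isRegular_zero : (0 : Language A).IsRegular :=
  .of_finite_closed (Set.finite_singleton 0) (by rintro _ rfl a; rfl) rfl

theorem leftQuotient_singleton_one (a : A) : (1 : Language A).leftQuotient [a] = 0 := by
  ext w
  simp [mem_leftQuotient, mem_one]

theorem isRegular_one : (1 : Language A).IsRegular := by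
  refine .of_finite_closed (F := {0, 1}) (by simp) ?_ (by simp)
  rintro _ (rfl | rfl) a
  · exact Or.inl rfl
  · exact Or.inl (leftQuotient_singleton_one a)

theorem isRegular_singleton_letter (a : A) : ({[a]} : Language A).IsRegular := by
  refine .of_finite_closed (F := {0, 1, {[a]}}) (by simp) ?_ (by simp)
  rintro _ (rfl | rfl | rfl) b
  · exact Or.inl rfl
  · exact Or.inl (leftQuotient_singleton_one b)
  · by_cases h : b = a
    · right; left
      ext w
      change b :: w = [a] ↔ w = []
      simp [h]
    · left
      ext w
      change b :: w = [a] ↔ False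
      simp [h]

theorem IsRegular.mul {l m : Language A} (hl : l.IsRegular) (hm : m.IsRegular) :
    (l * m).IsRegular := by
  refine .of_finite_closed (F := Set.image2 (fun k T ↦ k * m + sSup T)
    (Set.range l.leftQuotient) (𝒫 Set.range m.leftQuotient))
    (hl.finite_range_leftQuotient.image2 _ hm.finite_range_leftQuotient.finite_subsets) ?_
    ⟨l, ⟨[], rfl⟩, ∅, Set.empty_subset _, by
      ext w; simp only [mem_add, mem_sSup]; simp⟩
  rintro _ ⟨k, hk, T, hT, rfl⟩ a
  have hT' : (fun j ↦ j.leftQuotient [a]) '' T ⊆ Set.range m.leftQuotient := by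
    rintro _ ⟨j, hj, rfl⟩
    exact leftQuotient_singleton_mem_range (hT hj) a
  refine ⟨k.leftQuotient [a], leftQuotient_singleton_mem_range hk a, ?_⟩
  by_cases h : [] ∈ k
  · refine ⟨insert (m.leftQuotient [a]) ((fun j ↦ j.leftQuotient [a]) '' T),
      Set.insert_subset ⟨[a], rfl⟩ hT', ?_⟩
    simp only [leftQuotient_singleton_add, leftQuotient_singleton_mul_of_nil_mem h,
      leftQuotient_singleton_sSup, sSup_insert, add_assoc]
    rfl
  · refine ⟨_, hT', ?_⟩
    simp only [leftQuotient_singleton_add, leftQuotient_singleton_mul_of_nil_notMem h,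
      leftQuotient_singleton_sSup]

theorem IsRegular.kstar {l : Language A} (hl : l.IsRegular) : (l∗).IsRegular := by
  refine .of_finite_closed
    (F := insert (l∗) ((fun T ↦ sSup T * l∗) '' (𝒫 Set.range l.leftQuotient)))
    ((hl.finite_range_leftQuotient.finite_subsets.image _).insert _) ?_ (Set.mem_insert _ _)
  rintro _ (rfl | ⟨T, hT, rfl⟩) a
  · refine Or.inr ⟨{l.leftQuotient [a]}, Set.singleton_subset_iff.2 ⟨[a], rfl⟩, ?_⟩
    simp only [sSup_singleton, leftQuotient_singleton_kstar]
  have hT' : (fun j ↦ j.leftQuotient [a]) '' T ⊆ Set.range l.leftQuotient := by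
    rintro _ ⟨j, hj, rfl⟩
    exact leftQuotient_singleton_mem_range (hT hj) a
  right
  by_cases h : [] ∈ sSup T
  · refine ⟨insert (l.leftQuotient [a]) ((fun j ↦ j.leftQuotient [a]) '' T),
      Set.insert_subset ⟨[a], rfl⟩ hT', ?_⟩
    simp only [leftQuotient_singleton_mul_of_nil_mem h, leftQuotient_singleton_kstar,
      leftQuotient_singleton_sSup, sSup_insert, ← add_mul]
    rw [add_comm]
    rfl
  · refine ⟨_, hT', ?_⟩
    simp only [leftQuotient_singleton_mul_of_nil_notMem h, leftQuotient_singleton_sSup]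

end Language

theorem RegularExpression.isRegular_matches' {A : Type*} (e : RegularExpression A) :
    e.matches'.IsRegular := by
  induction e with
  | zero => exact Language.isRegular_zero
  | epsilon => exact Language.isRegular_one
  | char a => exact Language.isRegular_singleton_letter a
  | plus e f he hf => exact he.add hf
  | comp e f he hf => exact he.mul hf
  | star e he => exact he.kstar

/-! ### Denotable languages -/

/-- The languages denoted by regular expressions form a subsemiring. -/
def denotable (A : Type*) : Subsemiring (Language A) where
  carrier := Set.range RegularExpression.matches'
  zero_mem' := ⟨0, rfl⟩
  one_mem' := ⟨1, rfl⟩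
  add_mem' := by rintro _ _ ⟨e, rfl⟩ ⟨f, rfl⟩; exact ⟨e + f, rfl⟩
  mul_mem' := by rintro _ _ ⟨e, rfl⟩ ⟨f, rfl⟩; exact ⟨e * f, rfl⟩

theorem mem_denotable {A : Type*} {l : Language A} :
    l ∈ denotable A ↔ ∃ e : RegularExpression A, e.matches' = l :=
  Iff.rfl

theorem kstar_mem_denotable {A : Type*} {l : Language A} (hl : l ∈ denotable A) :
    l∗ ∈ denotable A := by
  obtain ⟨e, rfl⟩ := hl
  exact ⟨e.star, rfl⟩

/-- Solutions of a finite linear system with denotable coefficients, whose matrix entries do not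
contain the empty word, are denotable. -/
theorem mem_denotable_of_linear_system_fin {A : Type*} : ∀ {n : ℕ}
    (m : Fin n → Fin n → Language A) (b x : Fin n → Language A)
    (_ : ∀ i j, m i j ∈ denotable A) (_ : ∀ i j, [] ∉ m i j) (_ : ∀ i, b i ∈ denotable A)
    (_ : ∀ i, x i = ∑ j, m i j * x j + b i) (i : Fin n), x i ∈ denotable A
  | 0, _, _, _, _, _, _, _, i => i.elim0
  | n + 1, m, b, x, hm, hnil, hb, hx, i => by
    have hstar := kstar_mem_denotable (hm 0 0)
    have hzero : x 0 = (m 0 0)∗ * (∑ j : Fin n, m 0 j.succ * x j.succ + b 0) := by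
      rw [← Language.self_eq_mul_add_iff (hnil 0 0), ← add_assoc, ← Fin.sum_univ_succ
        (fun j ↦ m 0 j * x j)]
      exact hx 0
    have hsucc : ∀ i : Fin n, x i.succ ∈ denotable A := by
      refine mem_denotable_of_linear_system_fin
        (fun i j ↦ m i.succ j.succ + m i.succ 0 * ((m 0 0)∗ * m 0 j.succ))
        (fun i ↦ b i.succ + m i.succ 0 * ((m 0 0)∗ * b 0)) _
        (fun i j ↦ add_mem (hm _ _) (mul_mem (hm _ _) (mul_mem hstar (hm _ _))))
        (fun i j ↦ ?_)
        (fun i ↦ add_mem (hb _) (mul_mem (hm _ _) (mul_mem hstar (hb _)))) (fun i ↦ ?_)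
      · simp only [Language.mem_add, Language.nil_mem_mul, hnil, false_and, or_self, not_false_iff]
      · conv_lhs => rw [hx, Fin.sum_univ_succ, hzero]
        simp only [add_mul, mul_add, Finset.sum_add_distrib, Finset.mul_sum, mul_assoc]
        abel
    refine Fin.cases ?_ hsucc i
    rw [hzero]
    exact mul_mem hstar (add_mem (sum_mem fun j _ ↦ mul_mem (hm _ _) (hsucc j)) (hb 0))

theorem mem_denotable_of_linear_system {A ι : Type*} [Fintype ι]
    (m : ι → ι → Language A) (b x : ι → Language A)
    (hm : ∀ i j, m i j ∈ denotable A) (hnil : ∀ i j, [] ∉ m i j) (hb : ∀ i, b i ∈ denotable A)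
    (hx : ∀ i, x i = ∑ j, m i j * x j + b i) (i : ι) : x i ∈ denotable A := by
  let e := Fintype.equivFin ι
  have := mem_denotable_of_linear_system_fin (fun i j ↦ m (e.symm i) (e.symm j))
    (b ∘ e.symm) (x ∘ e.symm) (fun _ _ ↦ hm _ _) (fun _ _ ↦ hnil _ _) (fun _ ↦ hb _)
    (fun i ↦ by
      simp only [Function.comp_apply]
      rw [e.symm.sum_comp (fun j ↦ m (e.symm i) j * x j)]
      exact hx _) (e i)
  simpa using this

/-! ### Automata -/

theorem lang_eq_sum {S A : Type*} [Fintype A] (o : S → Bool) (t : S → A → S) (s : S) :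
    lang o t s = ∑ a, ({[a]} : Language A) * lang o t (t s a) + if o s then 1 else 0 := by
  ext w
  rw [Language.mem_add, Language.mem_finset_sum]
  have hletter (a : A) (u : List A) : u ∈ ({[a]} : Language A) ↔ u = [a] := Iff.rfl
  simp only [Finset.mem_univ, true_and, Language.mem_mul, hletter, exists_eq_left]
  have hmem (s : S) (w : List A) : w ∈ lang o t s ↔ o (dst t s w) = true := Iff.rfl
  cases w with
  | nil => cases h : o s <;> simp [hmem, dst, h, Language.mem_one]
  | cons a w => cases h : o s <;> simp [hmem, dst, Language.mem_one]

theorem lang_mem_denotable {S A : Type*} [Fintype S] [Fintype A] (o : S → Bool) (t : S → A → S)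
    (s : S) : lang o t s ∈ denotable A := by
  classical
  refine mem_denotable_of_linear_system
    (fun s s' ↦ ∑ a, if t s a = s' then ({[a]} : Language A) else 0)
    (fun s ↦ if o s then 1 else 0) (lang o t) (fun s s' ↦ sum_mem fun a _ ↦ ?_)
    (fun s s' ↦ ?_) (fun s ↦ ?_) (fun s ↦ ?_) s
  · split_ifs
    · exact ⟨.char a, rfl⟩
    · exact zero_mem _
  · simp only [Language.mem_finset_sum, not_exists, not_and]
    intro a _
    split_ifs
    · exact fun h ↦ List.cons_ne_nil a [] (Eq.symm h)
    · exact Language.notMem_zero _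
  · split_ifs
    · exact one_mem _
    · exact zero_mem _
  · rw [lang_eq_sum]
    simp only [Finset.sum_mul, ite_mul, zero_mul]
    rw [Finset.sum_comm]
    simp

theorem DFA.dst_step {A S : Type*} (M : DFA A S) (s : S) (w : List A) :
    dst M.step s w = M.evalFrom s w := by
  induction w generalizing s with
  | nil => rfl
  | cons a w ih => exact ih _

/-- Kleene's theorem: a language is denoted by a regular expression iff it is recognized
by a state of a finite deterministic automaton. -/
theorem kleene_theorem {A : Type*} [Fintype A] [DecidableEq A] (l : Language A) :
    (∃ e : RegularExpression A, l = e.matches') ↔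
      (∃ (S : Type) (_ : Fintype S) (o : S → Bool) (t : S → A → S) (s : S),
        l = lang o t s) := by
  classical
  constructor
  · rintro ⟨e, rfl⟩
    obtain ⟨S, hS, M, hM⟩ := e.isRegular_matches'
    refine ⟨S, hS, fun s ↦ decide (s ∈ M.accept), M.step, M.start, ?_⟩
    rw [← hM]
    ext w
    change _ ↔ decide (dst M.step M.start w ∈ M.accept) = true
    rw [decide_eq_true_iff, M.dst_step]
    rfl
  · rintro ⟨S, _, o, t, s, rfl⟩
    obtain ⟨e, he⟩ := mem_denotable.1 (lang_mem_denotable o t s)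
    exact ⟨e, he.symm⟩
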